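/- arXiv:2105.04418 — 4 statements merged into one kernel-verified Lean document; each statement's English description precedes it below -/
import Mathlib

section
/- Let n ≥ 1 and let f : ℝⁿ → ℝ be a continuously differentiable Ouroboros function, i.e. f(f(x),...,f(x)) = f(x) for all x ∈ ℝⁿ. Then for every point x ∈ ℝⁿ and every index i ∈ {1,...,n}, one has (∑_{k=1}^{n} ∂f/∂x_k evaluated at the diagonal point (f(x),...,f(x)) − 1) · (∂f/∂x_i evaluated at x) = 0; that is, the factored chain-rule identity (∑_k f_{x_k}(f(x),...,f(x))) · f_{x_i}(x) = f_{x_i}(x) holds identically. -/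
/-- For a C¹ Ouroboros function `f : ℝⁿ → ℝ` (i.e.
`f (f x, ..., f x) = f x` for all `x`), the factored chain-rule identity
`(∑ k, f_{x_k}(f x, ..., f x) - 1) * f_{x_i}(x) = 0` holds at every point
`x` and index `i`. -/
theorem ouroboros_factored_chain_rule
    (n : ℕ) (hn : 1 ≤ n) (f : (Fin n → ℝ) → ℝ)
    (hf : ContDiff ℝ 1 f)
    (hO : ∀ x : Fin n → ℝ, f (fun _ => f x) = f x) :
    ∀ (x : Fin n → ℝ) (i : Fin n),
      ((∑ k : Fin n, fderiv ℝ f (fun _ => f x) (Pi.single k 1)) - 1) *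
        fderiv ℝ f x (Pi.single i 1) = 0 := by
  intro x i
  have hd : Differentiable ℝ f := hf.differentiable (by norm_num)
  have h1 : HasFDerivAt (fun y : Fin n → ℝ => (fun _ : Fin n => f y))
      (ContinuousLinearMap.pi (fun _ : Fin n => fderiv ℝ f x)) x :=
    hasFDerivAt_pi.2 (fun _ => (hd x).hasFDerivAt)
  have h2 : HasFDerivAt f (fderiv ℝ f (fun _ => f x)) (fun _ : Fin n => f x) :=
    (hd _).hasFDerivAt
  have h3 := HasFDerivAt.comp x h2 h1
  have h4 : (f ∘ fun y : Fin n → ℝ => (fun _ : Fin n => f y)) = f := funext hO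
  rw [h4] at h3
  have h5 := congrArg (fun L => L (Pi.single i (1 : ℝ))) (h3.unique (hd x).hasFDerivAt)
  have h6 : (ContinuousLinearMap.pi (fun _ : Fin n => fderiv ℝ f x)) (Pi.single i (1 : ℝ))
      = (fderiv ℝ f x (Pi.single i 1)) • ∑ k : Fin n, (Pi.single k (1 : ℝ) : Fin n → ℝ) := by
    ext j
    simp [Finset.sum_apply, Pi.single_apply]
  simp only [ContinuousLinearMap.comp_apply] at h5
  rw [h6, map_smul, map_sum, smul_eq_mul] at h5
  linarith
end

section
/- Let n ≥ 1 and let f : ℝⁿ → ℝ be a continuously differentiable Ouroboros function, i.e. f(f(x),...,f(x)) = f(x) for all x ∈ ℝⁿ. If at some point x ∈ ℝⁿ there is an index i with ∂f/∂x_i(x) ≠ 0, then the sum of the Ouroboros derivatives of f at that point equals one: ∑_{k=1}^{n} f_{x_k}(f(x),...,f(x)) = 1, where f_{x_k}(f(x),...,f(x)) denotes the partial derivative ∂f/∂x_k evaluated at the diagonal point (f(x),...,f(x)). -/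
/-- For a C¹ Ouroboros function `f : ℝⁿ → ℝ`, if at some point
`x` some partial derivative `∂f/∂x_i (x)` is nonzero, then the sum of the
Ouroboros derivatives (the partials of `f` at the diagonal point
`(f x, ..., f x)`) equals `1`. -/
theorem ouroboros_derivatives_sum_eq_one
    (n : ℕ) (hn : 1 ≤ n) (f : (Fin n → ℝ) → ℝ)
    (hf : ContDiff ℝ 1 f)
    (hO : ∀ x : Fin n → ℝ, f (fun _ => f x) = f x)
    (x : Fin n → ℝ) (i : Fin n)
    (hi : fderiv ℝ f x (Pi.single i 1) ≠ 0) :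
    ∑ k : Fin n, fderiv ℝ f (fun _ => f x) (Pi.single k 1) = 1 := by
  have hd : Differentiable ℝ f := hf.differentiable (by norm_num)
  have h1 : HasFDerivAt f (fderiv ℝ f x) x := (hd x).hasFDerivAt
  have h2 : HasFDerivAt (fun y : Fin n → ℝ => (fun _ : Fin n => f y))
      (ContinuousLinearMap.pi fun _ : Fin n => fderiv ℝ f x) x :=
    hasFDerivAt_pi.2 fun _ => h1
  have h3 : HasFDerivAt f (fderiv ℝ f (fun _ => f x)) (fun _ => f x) := (hd _).hasFDerivAt
  have h4 := HasFDerivAt.comp x h3 h2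
  have h5 : (f ∘ fun y : Fin n → ℝ => (fun _ : Fin n => f y)) = f := funext hO
  rw [h5] at h4
  have h6 := DFunLike.congr_fun (h4.unique h1) (Pi.single i 1)
  have h7 : (ContinuousLinearMap.pi fun _ : Fin n => fderiv ℝ f x) (Pi.single i 1)
      = (fderiv ℝ f x (Pi.single i 1)) • ∑ k : Fin n, (Pi.single k (1 : ℝ) : Fin n → ℝ) := by
    ext j
    simp [Finset.sum_apply, Pi.single_apply]
  rw [ContinuousLinearMap.comp_apply, h7, map_smul, map_sum, smul_eq_mul] at h6
  exact mul_left_cancel₀ hi (by rw [h6, mul_one])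
end

section
/- Let n ≥ 1 and let f : ℝⁿ → ℝ be a continuously differentiable Ouroboros function, i.e. f(f(x),...,f(x)) = f(x) for all x ∈ ℝⁿ, which is moreover symmetric: f(x_{σ(1)},...,x_{σ(n)}) = f(x_1,...,x_n) for every permutation σ of {1,...,n} and every x ∈ ℝⁿ. If at some point x ∈ ℝⁿ there is an index i with ∂f/∂x_i(x) ≠ 0, then every Ouroboros derivative of f at x equals 1/n: f_{x_k}(f(x),...,f(x)) = 1/n for all k ∈ {1,...,n}, and consequently ∑_{k=1}^{n} f_{x_k}(f(x),...,f(x)) = 1. -/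
/-- For a C¹ symmetric Ouroboros function `f : ℝⁿ → ℝ`, if at
some point `x` some partial derivative `∂f/∂x_i (x)` is nonzero, then every
Ouroboros derivative at `x` equals `1/n`, and consequently their sum is `1`. -/
theorem ouroboros_derivatives_eq_one_div_n
    (n : ℕ) (hn : 1 ≤ n) (f : (Fin n → ℝ) → ℝ)
    (hf : ContDiff ℝ 1 f)
    (hO : ∀ x : Fin n → ℝ, f (fun _ => f x) = f x)
    (hsymm : ∀ (σ : Equiv.Perm (Fin n)) (x : Fin n → ℝ),
      f (fun j => x (σ j)) = f x)
    (x : Fin n → ℝ) (i : Fin n)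
    (hi : fderiv ℝ f x (Pi.single i 1) ≠ 0) :
    (∀ k : Fin n, fderiv ℝ f (fun _ => f x) (Pi.single k 1) = 1 / n) ∧
      ∑ k : Fin n, fderiv ℝ f (fun _ => f x) (Pi.single k 1) = 1 := by
  have hd : Differentiable ℝ f := hf.differentiable (by norm_num)
  have hL := (hd (fun _ => f x)).hasFDerivAt
  set L := fderiv ℝ f (fun _ => f x) with hLdef
  have hx := (hd x).hasFDerivAt
  have hone : L (fun _ => 1) = 1 := by
    have h1 : HasFDerivAt (fun y : Fin n → ℝ => (fun _ : Fin n => f y))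
        (ContinuousLinearMap.pi (fun _ : Fin n => fderiv ℝ f x)) x :=
      hasFDerivAt_pi.2 (fun _ => hx)
    have h2 := HasFDerivAt.comp x (g := f) (g' := L) hL h1
    have h3 : (f ∘ fun y : Fin n → ℝ => (fun _ : Fin n => f y)) = f := funext hO
    rw [h3] at h2
    have h4 := DFunLike.congr_fun (h2.unique hx) (Pi.single i 1)
    have h5 : L (fun _ : Fin n => fderiv ℝ f x (Pi.single i 1))
        = fderiv ℝ f x (Pi.single i 1) := h4
    have h6 : (fun _ : Fin n => fderiv ℝ f x (Pi.single i 1))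
        = fderiv ℝ f x (Pi.single i 1) • (fun _ : Fin n => (1 : ℝ)) := by
      ext j; simp
    rw [h6, map_smul, smul_eq_mul] at h5
    exact mul_left_cancel₀ hi (by rw [h5, mul_one])
  have hsum : ∑ k : Fin n, L (Pi.single k 1) = 1 := by
    rw [← map_sum, Finset.univ_sum_single (fun _ : Fin n => (1 : ℝ))]
    exact hone
  have heq : ∀ k l : Fin n, L (Pi.single k 1) = L (Pi.single l 1) := by
    intro k l
    let P : (Fin n → ℝ) →L[ℝ] (Fin n → ℝ) :=
      ContinuousLinearMap.pi (fun j => ContinuousLinearMap.proj (Equiv.swap k l j))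
    have h2 := HasFDerivAt.comp (fun _ : Fin n => f x) (g := f) (g' := L) (f := P) hL
      P.hasFDerivAt
    have h3 : f ∘ P = f := funext (fun y => hsymm (Equiv.swap k l) y)
    rw [h3] at h2
    have h4 : L (P (Pi.single k 1)) = L (Pi.single k 1) :=
      DFunLike.congr_fun (h2.unique hL) (Pi.single k 1)
    have h5 : P (Pi.single k 1) = Pi.single l 1 := by
      ext j
      change (Pi.single k 1 : Fin n → ℝ) (Equiv.swap k l j) = _
      simp only [Pi.single_apply]
      congr 1
      rw [Equiv.swap_apply_eq_iff, Equiv.swap_apply_left]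
    rw [← h4, h5]
  refine ⟨fun k => ?_, hsum⟩
  have h : ∑ l : Fin n, L (Pi.single l 1) = n * L (Pi.single k 1) := by
    rw [Finset.sum_congr rfl (fun l _ => heq l k)]; simp
  have hn0 : (n : ℝ) ≠ 0 := by positivity
  rw [eq_div_iff hn0, mul_comm, ← h, hsum]
end

section
/- Let f : ℝ → ℝ be a differentiable, nonconstant function satisfying the univariate Ouroboros equation f(f(x)) = f(x) for all x ∈ ℝ. Then there exists a point x ∈ ℝ at which f'(f(x)) = 1. -/
/-- A differentiable, nonconstant univariate Ouroboros function
`f : ℝ → ℝ` has a point `x` where the Ouroboros derivative `f' (f x)` equals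
`1`. -/
theorem ouroboros_derivative_exists_eq_one
    (f : ℝ → ℝ) (hf : Differentiable ℝ f)
    (hO : ∀ x : ℝ, f (f x) = f x)
    (hnc : ¬ ∃ c : ℝ, ∀ x : ℝ, f x = c) :
    ∃ x : ℝ, deriv f (f x) = 1 := by
  by_contra hne
  apply hnc
  refine ⟨f 0, fun x => is_const_of_deriv_eq_zero hf (fun y => ?_) x 0⟩
  by_contra hy
  apply hne
  refine ⟨y, ?_⟩
  have h1 : HasDerivAt (f ∘ f) (deriv f (f y) * deriv f y) y :=
    (hf (f y)).hasDerivAt.comp y (hf y).hasDerivAt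
  have h2 : f ∘ f = f := funext hO
  rw [h2] at h1
  have h3 := h1.unique (hf y).hasDerivAt
  exact mul_right_cancel₀ hy (by rw [h3, one_mul])
end
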